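/- Let f be an expanding Lorenz map with critical point c admitting a primary n(k)-cycle z_0 < z_1 < ⋯ < z_{n-k-1} < c < z_{n-k} < ⋯ < z_{n-1}, and put u = f^{n-1}(0), v = f^{n-1}(1). If z_{k-1} = f(0), then u = z_{n-k-1} and the forward orbit of u never meets (u,v), i.e. f^i(u) ∉ (u,v) for all i ≥ 0. If z_k = f(1), then v = z_{n-k} and f^i(v) ∉ (u,v) for all i ≥ 0. In particular, if z_{k-1} = f(0) or z_k = f(1), then it is not the case that both the forward orbit of u and the forward orbit of v enter (u,v). -/

import Mathlib

open Set Filter Topology Function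

/-- `f` is an expanding Lorenz map on `[a,b]` with critical point `c`:
continuous and strictly increasing on `[a,c)` and `(c,b]`, with
`lim_{x→c⁻} f(x) = b`, `lim_{x→c⁺} f(x) = a`, and differentiable with
derivative uniformly greater than `1` outside a finite set. -/
structure IsExpandingLorenzOn (f : ℝ → ℝ) (c a b : ℝ) : Prop where
  a_lt_c : a < c
  c_lt_b : c < b
  mapsTo : Set.MapsTo f (Set.Icc a b) (Set.Icc a b)
  mono_left : StrictMonoOn f (Set.Ico a c)
  mono_right : StrictMonoOn f (Set.Ioc c b)
  cont_left : ContinuousOn f (Set.Ico a c)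
  cont_right : ContinuousOn f (Set.Ioc c b)
  lim_left : Filter.Tendsto f (nhdsWithin c (Set.Iio c)) (nhds b)
  lim_right : Filter.Tendsto f (nhdsWithin c (Set.Ioi c)) (nhds a)
  expanding : ∃ F : Set ℝ, F.Finite ∧ ∃ lam : ℝ, 1 < lam ∧
    ∀ x ∈ Set.Icc a b \ F, ∃ d : ℝ, HasDerivWithinAt f d (Set.Icc a b) x ∧ lam ≤ d

/-- An expanding Lorenz map on `[0,1]` with critical point `c`. -/
def IsExpandingLorenz (f : ℝ → ℝ) (c : ℝ) : Prop := IsExpandingLorenzOn f c 0 1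

/-- A primary `n(k)`-cycle `z 0 < z 1 < ⋯ < z (n-k-1) < c < z (n-k) < ⋯ < z (n-1)`
for a Lorenz map `f` with critical point `c`. -/
structure IsPrimaryCycle (f : ℝ → ℝ) (c : ℝ) (n k : ℕ) (z : ℕ → ℝ) : Prop where
  k_pos : 0 < k
  k_lt_n : k < n
  coprime : Nat.Coprime n k
  mem : ∀ i < n, z i ∈ Set.Icc (0:ℝ) 1
  mono : ∀ i j : ℕ, i < j → j < n → z i < z j
  left_of_c : ∀ i < n - k, z i < c
  right_of_c : ∀ i : ℕ, n - k ≤ i → i < n → c < z i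
  step : ∀ i < n, f (z i) = z ((i + k) % n)
  le_f0 : z (k - 1) ≤ f 0
  f1_le : f 1 ≤ z k

/-- `g` is a renormalization `(f^l, f^r)` of the Lorenz map `f` on the
renormalization interval `[u,v]`: on `[u,c)` (resp. `(c,v]`) the map `g`
is given by `f^[l]` (resp. `f^[r]`), with values given by one-sided limits
at points where some earlier iterate hits `c`, and `g` is itself an
expanding Lorenz map on `[u,v]` with critical point `c`. -/
structure IsRenormalization (f : ℝ → ℝ) (c : ℝ) (l r : ℕ) (u v : ℝ) (g : ℝ → ℝ) : Prop where
  one_lt_l : 1 < l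
  one_lt_r : 1 < r
  u_nonneg : 0 ≤ u
  u_lt_c : u < c
  c_lt_v : c < v
  v_le_one : v ≤ 1
  proper : 0 < u ∨ v < 1
  eq_left : ∀ x ∈ Set.Ico u c, (∀ i < l, f^[i] x ≠ c) → g x = f^[l] x
  eq_right : ∀ x ∈ Set.Ioc c v, (∀ i < r, f^[i] x ≠ c) → g x = f^[r] x
  lim_left_pt : ∀ x ∈ Set.Ico u c,
    Filter.Tendsto (f^[l]) (nhdsWithin x (Set.Ioi x)) (nhds (g x))
  lim_right_pt : ∀ x ∈ Set.Ioc c v,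
    Filter.Tendsto (f^[r]) (nhdsWithin x (Set.Iio x)) (nhds (g x))
  lim_c_left : Filter.Tendsto (f^[l]) (nhdsWithin c (Set.Iio c)) (nhds v)
  lim_c_right : Filter.Tendsto (f^[r]) (nhdsWithin c (Set.Ioi c)) (nhds u)
  lorenz : IsExpandingLorenzOn g c u v

/-- The forward orbit of `x` enters the set `S` with a `c`-free prefix:
there is `n ≥ 0` with `f^[i] x ≠ c` for `0 ≤ i < n` and `f^[n] x ∈ S`. -/
def CFreeEnters (f : ℝ → ℝ) (c : ℝ) (S : Set ℝ) (x : ℝ) : Prop :=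
  ∃ n : ℕ, (∀ i < n, f^[i] x ≠ c) ∧ f^[n] x ∈ S

/-- `N(U) = min {n ≥ 0 : f^[n] z = c for some z ∈ U}`. -/
noncomputable def hitTime (f : ℝ → ℝ) (c : ℝ) (U : Set ℝ) : ℕ :=
  sInf {n : ℕ | ∃ z ∈ U, f^[n] z = c}

/-- `x ∈ [0,1]` is a `c`-free periodic point of `f` of (exact) period `p`. -/
def IsCFreePeriodic (f : ℝ → ℝ) (c x : ℝ) (p : ℕ) : Prop :=
  x ∈ Set.Icc (0:ℝ) 1 ∧ f^[p] x = x ∧ (∀ i : ℕ, 0 < i → i < p → f^[i] x ≠ x) ∧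
    ∀ i < p, f^[i] x ≠ c

/-- Topological transitivity of `f` as a map of `[0,1]`. -/
def LorenzTransitive (f : ℝ → ℝ) : Prop :=
  ∀ U V : Set ℝ, IsOpen U → IsOpen V →
    (U ∩ Set.Icc 0 1).Nonempty → (V ∩ Set.Icc 0 1).Nonempty →
    ∃ n : ℕ, (f^[n] '' (U ∩ Set.Icc 0 1) ∩ (V ∩ Set.Icc 0 1)).Nonempty

/-- `f` is locally eventually onto: every nonempty (relatively) open subset of `[0,1]`
contains open intervals mapped homeomorphically onto `(0,c)` and onto `(c,1)`
by suitable iterates of `f`. -/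
def LocallyEventuallyOnto (f : ℝ → ℝ) (c : ℝ) : Prop :=
  ∀ U : Set ℝ, IsOpen U → (U ∩ Set.Icc 0 1).Nonempty →
    (∃ a b : ℝ, a < b ∧ Set.Ioo a b ⊆ U ∩ Set.Icc 0 1 ∧ ∃ n : ℕ,
      ContinuousOn (f^[n]) (Set.Ioo a b) ∧ Set.InjOn (f^[n]) (Set.Ioo a b) ∧
        f^[n] '' Set.Ioo a b = Set.Ioo 0 c) ∧
    (∃ a b : ℝ, a < b ∧ Set.Ioo a b ⊆ U ∩ Set.Icc 0 1 ∧ ∃ n : ℕ,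
      ContinuousOn (f^[n]) (Set.Ioo a b) ∧ Set.InjOn (f^[n]) (Set.Ioo a b) ∧
        f^[n] '' Set.Ioo a b = Set.Ioo c 1)

/-- The generalized backward orbit of `x`: points joined to `x` by a chain
following `f`, where at the critical point `c` the chain may continue with
either `0` or `1`. -/
def GenBackwardOrbit (f : ℝ → ℝ) (c x : ℝ) : Set ℝ :=
  {y | y ∈ Set.Icc (0:ℝ) 1 ∧ ∃ (k : ℕ) (w : ℕ → ℝ), w 0 = y ∧ w k = x ∧
    ∀ i < k, (w i ≠ c → w (i + 1) = f (w i)) ∧ (w i = c → w (i + 1) = 0 ∨ w (i + 1) = 1)}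

namespace IsPrimaryCycle

variable {f : ℝ → ℝ} {c : ℝ} {n k : ℕ} {z : ℕ → ℝ}

theorem monotone_of_lt (hz : IsPrimaryCycle f c n k z) {i j : ℕ} (hij : i ≤ j) (hj : j < n) :
    z i ≤ z j := by
  rcases hij.eq_or_lt with rfl | h
  · exact le_rfl
  · exact (hz.mono i j h hj).le

/-- The action of the iterates of `f` on a primary cycle. -/
theorem iterate_apply (hz : IsPrimaryCycle f c n k z) {i : ℕ} (hi : i < n) (m : ℕ) :
    f^[m] (z i) = z ((i + m * k) % n) := by
  have hn : 0 < n := (Nat.zero_le i).trans_lt hi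
  induction m with
  | zero => simp [Nat.mod_eq_of_lt hi]
  | succ m ih =>
    rw [Function.iterate_succ_apply', ih, hz.step _ (Nat.mod_lt _ hn), Nat.mod_add_mod]
    congr 2
    ring

/-- No point of a primary cycle lies in the gap containing the critical point. -/
theorem notMem_central_gap (hz : IsPrimaryCycle f c n k z) {j : ℕ} (hj : j < n) :
    z j ∉ Ioo (z (n - k - 1)) (z (n - k)) := by
  rintro ⟨h1, h2⟩
  have hk := hz.k_pos
  have hkn := hz.k_lt_n
  rcases Nat.lt_or_ge j (n - k) with h | h
  · exact absurd (hz.monotone_of_lt (i := j) (j := n - k - 1) (by omega) (by omega)) h1.not_ge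
  · exact absurd (hz.monotone_of_lt h hj) h2.not_ge

theorem sub_one_mul_mod (hz : IsPrimaryCycle f c n k z) : (n - 1) * k % n = n - k := by
  obtain ⟨k', rfl⟩ : ∃ k', k = k' + 1 := ⟨k - 1, by have := hz.k_pos; omega⟩
  obtain ⟨d, rfl⟩ : ∃ d, n = k' + 1 + d := ⟨n - (k' + 1), by have := hz.k_lt_n; omega⟩
  have hd : (k' + 1 + d - 1) * (k' + 1) = d + (k' + 1 + d) * k' := by
    rw [show k' + 1 + d - 1 = k' + d by omega]
    ring
  rw [hd, Nat.add_mul_mod_self_left, Nat.mod_eq_of_lt (by omega)]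
  omega

/-- `f` is monotone between neighbouring cycle points on the same side of `c`. -/
theorem apply_mem_Icc (hf : IsExpandingLorenz f c) (hz : IsPrimaryCycle f c n k z) {r : ℕ}
    (hr0 : 0 < r) (hrn : r < n) (hr : r ≠ n - k) {y : ℝ} (hy : y ∈ Icc (z (r - 1)) (z r)) :
    f y ∈ Icc (z ((r + k) % n - 1)) (z ((r + k) % n)) := by
  have hkn := hz.k_lt_n
  have hk := hz.k_pos
  have ha := hz.mem (r - 1) (by omega)
  have hb := hz.mem r hrn
  have hsa := hz.step (r - 1) (by omega)
  have hsb := hz.step r hrn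
  have hmod : (r - 1 + k) % n = (r + k) % n - 1 := by
    rcases Nat.lt_or_ge r (n - k) with h | h
    · rw [Nat.mod_eq_of_lt (by omega), Nat.mod_eq_of_lt (by omega)]
      omega
    · rw [Nat.mod_eq_sub_mod (by omega), Nat.mod_eq_sub_mod (a := r + k) (by omega),
        Nat.mod_eq_of_lt (by omega), Nat.mod_eq_of_lt (by omega)]
      omega
  rw [← hsb, ← hmod, ← hsa]
  rcases Nat.lt_or_ge r (n - k) with h | h
  · have hc := hz.left_of_c r h
    exact ⟨hf.mono_left.monotoneOn ⟨ha.1, (hy.1.trans hy.2).trans_lt hc⟩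
        ⟨ha.1.trans hy.1, hy.2.trans_lt hc⟩ hy.1,
      hf.mono_left.monotoneOn ⟨ha.1.trans hy.1, hy.2.trans_lt hc⟩ ⟨hb.1, hc⟩ hy.2⟩
  · have hc := hz.right_of_c (r - 1) (by omega) (by omega)
    exact ⟨hf.mono_right.monotoneOn ⟨hc, ha.2⟩ ⟨hc.trans_le hy.1, hy.2.trans hb.2⟩ hy.1,
      hf.mono_right.monotoneOn ⟨hc.trans_le hy.1, hy.2.trans hb.2⟩
        ⟨hc.trans_le (hy.1.trans hy.2), hb.2⟩ hy.2⟩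

/-- Points of `[z (k-1), z k]` follow the neighbouring cycle points up to time `n - 2`. -/
theorem iterate_mem_Icc (hf : IsExpandingLorenz f c) (hz : IsPrimaryCycle f c n k z) {x : ℝ}
    (hx : x ∈ Icc (z (k - 1)) (z k)) {m : ℕ} (hm : m + 2 ≤ n) :
    f^[m] x ∈ Icc (z ((m + 1) * k % n - 1)) (z ((m + 1) * k % n)) := by
  induction m with
  | zero => simpa [Nat.mod_eq_of_lt hz.k_lt_n] using hx
  | succ m ih =>
    have hpos : ∀ j, 0 < j → j < n → 0 < j * k % n := fun j h0 hj => by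
      refine Nat.pos_of_ne_zero fun h => ?_
      exact Nat.not_dvd_of_pos_of_lt h0 hj
        (hz.coprime.dvd_of_dvd_mul_right (Nat.dvd_of_mod_eq_zero h))
    have hkn := hz.k_lt_n
    have hnext : ((m + 1) * k % n + k) % n = (m + 1 + 1) * k % n := by
      rw [Nat.mod_add_mod]
      congr 1
      ring
    rw [Function.iterate_succ_apply', ← hnext]
    refine hz.apply_mem_Icc hf (hpos _ (by omega) (by omega)) (Nat.mod_lt _ (by omega)) ?_
      (ih (by omega))
    intro h
    rw [h, Nat.sub_add_cancel hkn.le, Nat.mod_self] at hnext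
    have := hpos (m + 1 + 1) (by omega) (by omega)
    omega

theorem iterate_sub_one_mem_central_gap (hf : IsExpandingLorenz f c)
    (hz : IsPrimaryCycle f c n k z) {x : ℝ} (hx : f x ∈ Icc (z (k - 1)) (z k)) :
    f^[n - 1] x ∈ Icc (z (n - k - 1)) (z (n - k)) := by
  have hkn := hz.k_lt_n
  have hk := hz.k_pos
  have h := hz.iterate_mem_Icc hf hx (m := n - 2) (by omega)
  rw [← Function.iterate_succ_apply, show n - 2 + 1 = n - 1 by omega, hz.sub_one_mul_mod] at h
  rwa [show (n - 2).succ = n - 1 by omega] at h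

theorem apply_zero_mem (hf : IsExpandingLorenz f c) (hz : IsPrimaryCycle f c n k z) :
    f 0 ∈ Icc (z (k - 1)) (z k) := by
  have hkn := hz.k_lt_n
  refine ⟨hz.le_f0, ?_⟩
  have hs := hz.step 0 (by omega)
  rw [zero_add, Nat.mod_eq_of_lt hkn] at hs
  rw [← hs]
  have h0 := (hz.mem 0 (by omega)).1
  exact hf.mono_left.monotoneOn ⟨le_rfl, hf.a_lt_c⟩ ⟨h0, hz.left_of_c 0 (by omega)⟩ h0

theorem apply_one_mem (hf : IsExpandingLorenz f c) (hz : IsPrimaryCycle f c n k z) :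
    f 1 ∈ Icc (z (k - 1)) (z k) := by
  have hkn := hz.k_lt_n
  have hk := hz.k_pos
  refine ⟨?_, hz.f1_le⟩
  have hs := hz.step (n - 1) (by omega)
  rw [Nat.mod_eq_sub_mod (by omega), Nat.mod_eq_of_lt (by omega),
    show n - 1 + k - n = k - 1 by omega] at hs
  rw [← hs]
  have h1 := (hz.mem (n - 1) (by omega)).2
  exact hf.mono_right.monotoneOn ⟨hz.right_of_c _ (by omega) (by omega), h1⟩
    ⟨hf.c_lt_b, le_rfl⟩ h1

/-- A point mapped to `z k` reaches `z (n - k)` at time `n - 1`. -/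
theorem iterate_sub_one_eq_of_apply_eq_right (hz : IsPrimaryCycle f c n k z) {x : ℝ}
    (hx : z k = f x) : f^[n - 1] x = z (n - k) := by
  have hkn := hz.k_lt_n
  have hk := hz.k_pos
  rw [show n - 1 = (n - 2) + 1 by omega, Function.iterate_succ_apply, ← hx,
    hz.iterate_apply hkn, ← hz.sub_one_mul_mod, show n - 1 = (n - 2) + 1 by omega]
  congr 2
  ring

/-- A point mapped to `z (k - 1)` reaches `z (n - k - 1)` at time `n - 1`. -/
theorem iterate_sub_one_eq_of_apply_eq_left (hz : IsPrimaryCycle f c n k z) {x : ℝ}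
    (hx : z (k - 1) = f x) : f^[n - 1] x = z (n - k - 1) := by
  have hkn := hz.k_lt_n
  have hk := hz.k_pos
  rw [show n - 1 = (n - 2) + 1 by omega, Function.iterate_succ_apply, ← hx,
    hz.iterate_apply (by omega)]
  congr 1
  have h := hz.sub_one_mul_mod
  have hdiv := Nat.div_add_mod ((n - 1) * k) n
  have hsum : (n - 1) * k = (n - 2) * k + k := by
    rw [show n - 1 = (n - 2) + 1 by omega]
    ring
  rw [h] at hdiv
  rw [show k - 1 + (n - 2) * k = (n - k - 1) + n * ((n - 1) * k / n) by omega,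
    Nat.add_mul_mod_self_left, Nat.mod_eq_of_lt (by omega)]

end IsPrimaryCycle

/-- boundary cases of a primary `n(k)`-cycle. -/
theorem primary_cycle_boundary_orbits
    (f : ℝ → ℝ) (c : ℝ) (n k : ℕ) (z : ℕ → ℝ)
    (hf : IsExpandingLorenz f c) (hz : IsPrimaryCycle f c n k z) :
    (z (k - 1) = f 0 → f^[n-1] (0:ℝ) = z (n - k - 1) ∧
      ∀ i : ℕ, f^[i] (f^[n-1] (0:ℝ)) ∉ Set.Ioo (f^[n-1] (0:ℝ)) (f^[n-1] (1:ℝ))) ∧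
    (z k = f 1 → f^[n-1] (1:ℝ) = z (n - k) ∧
      ∀ i : ℕ, f^[i] (f^[n-1] (1:ℝ)) ∉ Set.Ioo (f^[n-1] (0:ℝ)) (f^[n-1] (1:ℝ))) ∧
    ((z (k - 1) = f 0 ∨ z k = f 1) →
      ¬ ((∃ i : ℕ, f^[i] (f^[n-1] (0:ℝ)) ∈ Set.Ioo (f^[n-1] (0:ℝ)) (f^[n-1] (1:ℝ))) ∧
         (∃ j : ℕ, f^[j] (f^[n-1] (1:ℝ)) ∈ Set.Ioo (f^[n-1] (0:ℝ)) (f^[n-1] (1:ℝ))))) := by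
  have hkn := hz.k_lt_n
  have hu := hz.iterate_sub_one_mem_central_gap hf (hz.apply_zero_mem hf)
  have hv := hz.iterate_sub_one_mem_central_gap hf (hz.apply_one_mem hf)
  have avoid : ∀ j < n, ∀ i : ℕ,
      f^[i] (z j) ∉ Set.Ioo (f^[n-1] (0:ℝ)) (f^[n-1] (1:ℝ)) := fun j hj i h => by
    rw [hz.iterate_apply hj] at h
    exact hz.notMem_central_gap (Nat.mod_lt _ (by omega))
      ⟨hu.1.trans_lt h.1, h.2.trans_le hv.2⟩
  have left : z (k - 1) = f 0 → f^[n-1] (0:ℝ) = z (n - k - 1) ∧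
      ∀ i : ℕ, f^[i] (f^[n-1] (0:ℝ)) ∉ Set.Ioo (f^[n-1] (0:ℝ)) (f^[n-1] (1:ℝ)) := fun h => by
    have hu' := hz.iterate_sub_one_eq_of_apply_eq_left h
    refine ⟨hu', fun i hi => avoid (n - k - 1) (by omega) i ?_⟩
    rwa [← hu']
  have right : z k = f 1 → f^[n-1] (1:ℝ) = z (n - k) ∧
      ∀ i : ℕ, f^[i] (f^[n-1] (1:ℝ)) ∉ Set.Ioo (f^[n-1] (0:ℝ)) (f^[n-1] (1:ℝ)) := fun h => by
    have hv' := hz.iterate_sub_one_eq_of_apply_eq_right h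
    have hk := hz.k_pos
    refine ⟨hv', fun i hi => avoid (n - k) (by omega) i ?_⟩
    rwa [← hv']
  refine ⟨left, right, ?_⟩
  rintro (h | h) ⟨⟨i, hi⟩, ⟨j, hj⟩⟩
  · exact (left h).2 i hi
  · exact (right h).2 j hj
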